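/- For every real r > 0 there exists a constant C_r > 0 such that for every integer a ≥ 8 and every real number x with 1 ≤ x ≤ a^r, the number of pairs of integers (w, o) with w ≥ 1, o ≥ ⌊(a+2)·w/(a² + 3a + 3)⌋ + 2 and Nm((⌊−(a+1)·w/(a² + 3a + 3)⌋ + 1) − w·ρ + o·ρ²) ≤ x is at most C_r·((log a)²·x/a² + (x/a)^(2/3)). -/

import Mathlib

open NumberField

/-- The largest real root of `X³ - aX² - (a+3)X - 1` (for `a ≥ 7` this set of real roots
is nonempty and bounded above, so `sSup` picks out the largest root). -/
noncomputable def simplestCubicRoot (a : ℤ) : ℝ :=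
  sSup {x : ℝ | x ^ 3 - (a : ℝ) * x ^ 2 - ((a : ℝ) + 3) * x - 1 = 0}

open Finset

/-! ### The simplest cubic field -/

lemma simplestCubic_irreducible (a : ℤ) :
    Irreducible (Polynomial.X ^ 3 - Polynomial.C (a : ℚ) * Polynomial.X ^ 2
      - Polynomial.C ((a : ℚ) + 3) * Polynomial.X - 1) := by
  have hd : (Polynomial.X ^ 3 - Polynomial.C (a : ℚ) * Polynomial.X ^ 2
      - Polynomial.C ((a : ℚ) + 3) * Polynomial.X - 1).natDegree = 3 := by
    compute_degree!
  refine Polynomial.irreducible_of_degree_le_three_of_not_isRoot (by rw [hd]; decide) ?_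
  intro q hq
  have hq' : q ^ 3 - a * q ^ 2 - (a + 3) * q - 1 = 0 := by simpa using hq
  have hm : (Polynomial.X ^ 3 - Polynomial.C a * Polynomial.X ^ 2
      - Polynomial.C (a + 3) * Polynomial.X - 1 : Polynomial ℤ).Monic := by
    monicity!
  obtain ⟨z, rfl⟩ := isInteger_of_is_root_of_monic hm (r := q) (by simpa [map_ofNat] using hq')
  simp only [eq_intCast] at hq'
  have hz : z * (z ^ 2 - a * z - (a + 3)) = 1 := by
    have : ((z * (z ^ 2 - a * z - (a + 3)) : ℤ) : ℚ) = (1 : ℤ) := by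
      push_cast; linear_combination hq'
    exact_mod_cast this
  rcases Int.isUnit_iff.1 (IsUnit.of_mul_eq_one _ hz) with rfl | rfl
  · lia
  · lia

lemma norm_quadratic_eq {a : ℤ} {K : Type*} [Field K] [NumberField K] {θ : K}
    (hθ : θ ^ 3 - a * θ ^ 2 - (a + 3) * θ - 1 = 0) (htop : IntermediateField.adjoin ℚ {θ} = ⊤)
    {r₁ r₂ r₃ : ℝ} (h₁ : r₁ + r₂ + r₃ = a) (h₂ : r₁ * r₂ + r₁ * r₃ + r₂ * r₃ = -(a + 3))
    (h₃ : r₁ * r₂ * r₃ = 1) (u v w : ℤ) :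
    ((Algebra.norm ℚ ((u : K) - v * θ + w * θ ^ 2) : ℚ) : ℝ) =
      (u - v * r₁ + w * r₁ ^ 2) * (u - v * r₂ + w * r₂ ^ 2) * (u - v * r₃ + w * r₃ ^ 2) := by
  have hint : IsIntegral ℚ θ := Algebra.IsIntegral.isIntegral θ
  have htop' : Algebra.adjoin ℚ {θ} = ⊤ := by
    rw [← IntermediateField.adjoin_simple_toSubalgebra_of_isAlgebraic hint.isAlgebraic, htop,
      IntermediateField.top_toSubalgebra]
  have hmin : minpoly ℚ θ = Polynomial.X ^ 3 - Polynomial.C (a : ℚ) * Polynomial.X ^ 2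
      - Polynomial.C ((a : ℚ) + 3) * Polynomial.X - 1 :=
    (minpoly.eq_of_irreducible_of_monic (simplestCubic_irreducible a) (by simpa using hθ)
      (by monicity!)).symm
  let pb := PowerBasis.ofAdjoinEqTop hint htop'
  have hdim : pb.dim = 3 := by
    change (minpoly ℚ θ).natDegree = 3
    rw [hmin]; compute_degree!
  let b : Module.Basis (Fin 3) ℚ K := pb.basis.reindex (finCongr hdim)
  have hb : ∀ i, b i = θ ^ (i : ℕ) := fun i ↦ by
    rw [Module.Basis.reindex_apply, PowerBasis.basis_eq_pow]
    simp only [pb, PowerBasis.ofAdjoinEqTop_gen]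
    rfl
  have hrepr : ∀ x y z : ℚ, b.repr (x • b 0 + y • b 1 + z • b 2)
      = Finsupp.single 0 x + Finsupp.single 1 y + Finsupp.single 2 z := by
    intro x y z; simp
  have e0 : ((u : K) - v * θ + w * θ ^ 2) * b 0
      = (u : ℚ) • b 0 + (-v : ℚ) • b 1 + (w : ℚ) • b 2 := by
    simp only [hb, Algebra.smul_def]; simp; ring
  have e1 : ((u : K) - v * θ + w * θ ^ 2) * b 1
      = (w : ℚ) • b 0 + (u + (a + 3) * w : ℚ) • b 1 + (-v + a * w : ℚ) • b 2 := by
    simp only [hb, Algebra.smul_def]; simp; linear_combination (w : K) * hθ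
  have e2 : ((u : K) - v * θ + w * θ ^ 2) * b 2
      = (-v + a * w : ℚ) • b 0 + (w + (a + 3) * (-v + a * w) : ℚ) • b 1
        + ((u + (a + 3) * w) + a * (-v + a * w) : ℚ) • b 2 := by
    simp only [hb, Algebra.smul_def]; simp
    linear_combination ((w : K) * θ + (-v + a * w)) * hθ
  rw [Algebra.norm_eq_matrix_det b, Matrix.det_fin_three]
  simp only [Algebra.leftMulMatrix_eq_repr_mul, e0, e1, e2, hrepr]
  have hprod : (u - v * r₁ + w * r₁ ^ 2) * (u - v * r₂ + w * r₂ ^ 2) * (u - v * r₃ + w * r₃ ^ 2)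
      = u ^ 3 - u ^ 2 * v * (r₁ + r₂ + r₃)
        + u ^ 2 * w * ((r₁ + r₂ + r₃) ^ 2 - 2 * (r₁ * r₂ + r₁ * r₃ + r₂ * r₃))
        + u * v ^ 2 * (r₁ * r₂ + r₁ * r₃ + r₂ * r₃)
        - u * v * w * ((r₁ + r₂ + r₃) * (r₁ * r₂ + r₁ * r₃ + r₂ * r₃) - 3 * (r₁ * r₂ * r₃))
        + u * w ^ 2 * ((r₁ * r₂ + r₁ * r₃ + r₂ * r₃) ^ 2
          - 2 * (r₁ + r₂ + r₃) * (r₁ * r₂ * r₃))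
        - v ^ 3 * (r₁ * r₂ * r₃) + v ^ 2 * w * (r₁ * r₂ * r₃) * (r₁ + r₂ + r₃)
        - v * w ^ 2 * (r₁ * r₂ * r₃) * (r₁ * r₂ + r₁ * r₃ + r₂ * r₃)
        + w ^ 3 * (r₁ * r₂ * r₃) ^ 2 := by ring
  rw [hprod, h₁, h₂, h₃]
  simp
  ring

lemma simplestCubicRoot_spec {a : ℤ} (ha : 8 ≤ a) :
    (simplestCubicRoot a) ^ 3 - a * (simplestCubicRoot a) ^ 2
        - (a + 3) * simplestCubicRoot a - 1 = 0 ∧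
      (a : ℝ) + 1 < simplestCubicRoot a ∧ simplestCubicRoot a < a + 2 := by
  have ha' : (8 : ℝ) ≤ a := by exact_mod_cast ha
  have hcont : ContinuousOn (fun x : ℝ ↦ x ^ 3 - a * x ^ 2 - (a + 3) * x - 1)
      (Set.Icc ((a : ℝ) + 1) (a + 2)) := by fun_prop
  obtain ⟨ρ, ⟨hρ₁, hρ₂⟩, hρ⟩ := intermediate_value_Ioo (by linarith) hcont
    (show (0 : ℝ) ∈ Set.Ioo _ _ from ⟨by nlinarith, by nlinarith⟩)
  have hgreatest : IsGreatest {x : ℝ | x ^ 3 - (a : ℝ) * x ^ 2 - ((a : ℝ) + 3) * x - 1 = 0} ρ := by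
    refine ⟨hρ, fun x hx ↦ ?_⟩
    by_contra! hlt
    have hx' : x ^ 3 - (a : ℝ) * x ^ 2 - ((a : ℝ) + 3) * x - 1 = 0 := hx
    have hfac : (x - ρ) * (x * (x - a) + ρ * (ρ - a) + x * ρ - (a + 3)) = 0 := by
      simp only at hρ
      linear_combination hx' - hρ
    have : 0 < x * (x - a) + ρ * (ρ - a) + x * ρ - (a + 3) := by
      nlinarith [mul_pos (show 0 < x - a by linarith) (show 0 < x by linarith),
        mul_pos (show 0 < ρ - a by linarith) (show 0 < ρ by linarith),
        mul_pos (show 0 < x - a by linarith) (show 0 < ρ by linarith)]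
    have := mul_pos (show 0 < x - ρ by linarith) this
    linarith
  rw [simplestCubicRoot, hgreatest.csSup_eq]
  exact ⟨hρ, hρ₁, hρ₂⟩

/-! ### Lower bounds for the conjugates -/

lemma sail_conj_eq_sq {a x : ℝ} (hx : x ^ 3 - a * x ^ 2 - (a + 3) * x - 1 = 0) (hx1 : x + 1 ≠ 0) :
    (a + 2) * x ^ 2 - (a ^ 2 + 3 * a + 3) * x - (a + 1) = (x / (x + 1)) ^ 2 := by
  rw [div_pow, eq_div_iff (pow_ne_zero 2 hx1)]
  linear_combination ((a + 2) * x + (a + 1)) * hx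

/-- Rewriting `u - w x + o x²` in terms of `δ = u + (a+1)w/D` and `t = o - (a+2)w/D`. -/
lemma quadratic_eq_sail {a x : ℝ} (hx : x ^ 3 - a * x ^ 2 - (a + 3) * x - 1 = 0)
    (hx1 : x + 1 ≠ 0) (hD : a ^ 2 + 3 * a + 3 ≠ 0) (u w o : ℝ) :
    u - w * x + o * x ^ 2 = (u + (a + 1) * w / (a ^ 2 + 3 * a + 3))
      + w / (a ^ 2 + 3 * a + 3) * (x / (x + 1)) ^ 2
      + (o - (a + 2) * w / (a ^ 2 + 3 * a + 3)) * x ^ 2 := by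
  have h : w / (a ^ 2 + 3 * a + 3) * (a ^ 2 + 3 * a + 3) = w := div_mul_cancel₀ _ hD
  rw [← sail_conj_eq_sq hx hx1, mul_div_assoc, mul_div_assoc]
  linear_combination x * h

lemma norm_ge {a : ℤ} (ha : 8 ≤ a) {K : Type*} [Field K] [NumberField K] {σ : K →+* ℝ} {θ : K}
    (hσ : σ θ = simplestCubicRoot a) (htop : IntermediateField.adjoin ℚ {θ} = ⊤) (u w o : ℤ)
    {δ t : ℝ} (hδ : δ = u + (a + 1) * w / (a ^ 2 + 3 * a + 3))
    (ht : t = o - (a + 2) * w / (a ^ 2 + 3 * a + 3)) (hδ0 : 0 ≤ δ) (ht0 : 0 ≤ t) (hw : 0 ≤ w) :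
    (a : ℝ) ^ 2 * t * max (w : ℝ) t * max δ (t / (a + 3) ^ 2)
      ≤ ((Algebra.norm ℚ ((u : K) - w * θ + o * θ ^ 2) : ℚ) : ℝ) := by
  obtain ⟨hρ, hρ₁, hρ₂⟩ := simplestCubicRoot_spec ha
  have ha' : (8 : ℝ) ≤ a := by exact_mod_cast ha
  have hw' : (0 : ℝ) ≤ w := by exact_mod_cast hw
  have hθ : θ ^ 3 - a * θ ^ 2 - (a + 3) * θ - 1 = 0 := by
    apply σ.injective
    simpa [hσ, map_ofNat] using hρ
  set ρ := simplestCubicRoot a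
  have hρ0 : 0 < ρ := by linarith
  have hρ1 : ρ + 1 ≠ 0 := by linarith
  have hD : 0 < (a : ℝ) ^ 2 + 3 * a + 3 := by positivity
  have hs : 0 ≤ (w : ℝ) / (a ^ 2 + 3 * a + 3) := by positivity
  set r₂ : ℝ := -(ρ + 1) / ρ with hr₂
  set r₃ : ℝ := -1 / (ρ + 1) with hr₃
  have hroot₂ : r₂ ^ 3 - a * r₂ ^ 2 - (a + 3) * r₂ - 1 = 0 := by
    rw [hr₂]; field_simp; linear_combination hρ
  have hroot₃ : r₃ ^ 3 - a * r₃ ^ 2 - (a + 3) * r₃ - 1 = 0 := by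
    rw [hr₃]; field_simp; linear_combination -hρ
  have h2ne : r₂ + 1 = -1 / ρ := by rw [hr₂]; field_simp; ring
  have h3ne : r₃ + 1 = ρ / (ρ + 1) := by rw [hr₃]; field_simp; ring
  rw [norm_quadratic_eq hθ htop (r₁ := ρ) (r₂ := r₂) (r₃ := r₃)
    (by rw [hr₂, hr₃]; field_simp; linear_combination hρ)
    (by rw [hr₂, hr₃]; field_simp; linear_combination -hρ)
    (by rw [hr₂, hr₃]; field_simp),
    quadratic_eq_sail hρ hρ1 hD.ne', quadratic_eq_sail hroot₂ (by rw [h2ne]; positivity) hD.ne',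
    quadratic_eq_sail hroot₃ (by rw [h3ne]; positivity) hD.ne', ← hδ, ← ht]
  have b₁ : (a : ℝ) ^ 2 * t ≤ δ + w / (a ^ 2 + 3 * a + 3) * (ρ / (ρ + 1)) ^ 2 + t * ρ ^ 2 := by
    have : 0 ≤ (w : ℝ) / (a ^ 2 + 3 * a + 3) * (ρ / (ρ + 1)) ^ 2 := by positivity
    have : (a : ℝ) ^ 2 * t ≤ ρ ^ 2 * t := by gcongr; linarith
    linarith
  have b₂ : max (w : ℝ) t ≤ δ + w / (a ^ 2 + 3 * a + 3) * (r₂ / (r₂ + 1)) ^ 2 + t * r₂ ^ 2 := by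
    have e1 : r₂ / (r₂ + 1) = ρ + 1 := by rw [h2ne, hr₂]; field_simp
    have e2 : 1 ≤ r₂ ^ 2 := by
      rw [hr₂, div_pow, le_div_iff₀ (by positivity)]; nlinarith
    have e3 : (w : ℝ) ≤ w / (a ^ 2 + 3 * a + 3) * (ρ + 1) ^ 2 := by
      rw [div_mul_eq_mul_div, le_div_iff₀ hD]
      gcongr
      nlinarith
    rw [e1]
    apply max_le
    · linarith [mul_nonneg ht0 (sq_nonneg r₂)]
    · linarith [mul_nonneg hs (sq_nonneg (ρ + 1)), mul_le_mul_of_nonneg_left e2 ht0]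
  have b₃ : max δ (t / (a + 3) ^ 2)
      ≤ δ + w / (a ^ 2 + 3 * a + 3) * (r₃ / (r₃ + 1)) ^ 2 + t * r₃ ^ 2 := by
    have e1 : 0 ≤ (w : ℝ) / (a ^ 2 + 3 * a + 3) * (r₃ / (r₃ + 1)) ^ 2 := by positivity
    apply max_le
    · linarith [mul_nonneg ht0 (sq_nonneg r₃)]
    · have hle : ρ + 1 ≤ a + 3 := by linarith
      have : t / (a + 3) ^ 2 ≤ t * r₃ ^ 2 := by
        rw [show t * r₃ ^ 2 = t / (ρ + 1) ^ 2 by rw [hr₃]; field_simp]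
        gcongr
      linarith
  have hm : 0 ≤ max (w : ℝ) t := le_max_of_le_left hw'
  have hm' : 0 ≤ max δ (t / (a + 3) ^ 2) := le_max_of_le_left hδ0
  gcongr

/-! ### The constant coefficient -/

/-- `⌊-(a+1)w/(a²+3a+3)⌋ + 1` -/
noncomputable def constCoeff (a w : ℤ) : ℤ :=
  ⌊(-((a : ℝ) + 1) * w) / ((a : ℝ) ^ 2 + 3 * a + 3)⌋ + 1

/-- The representative of `(a+1)w` modulo `a²+3a+3` in `[1, a²+3a+3]`. -/
noncomputable def residue (a w : ℤ) : ℤ :=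
  (a ^ 2 + 3 * a + 3) * constCoeff a w + (a + 1) * w

lemma residue_div {a : ℤ} (ha : 0 ≤ a) (w : ℤ) :
    (residue a w : ℝ) / (a ^ 2 + 3 * a + 3)
      = constCoeff a w + (a + 1) * w / (a ^ 2 + 3 * a + 3) := by
  have ha' : (0 : ℝ) ≤ a := by exact_mod_cast ha
  rw [residue]
  push_cast
  field_simp

lemma residue_bounds {a : ℤ} (ha : 0 ≤ a) (w : ℤ) :
    1 ≤ residue a w ∧ residue a w ≤ a ^ 2 + 3 * a + 3 := by
  have ha' : (0 : ℝ) ≤ a := by exact_mod_cast ha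
  have hD : 0 < (a : ℝ) ^ 2 + 3 * a + 3 := by positivity
  have h := residue_div ha w
  have h1 := Int.floor_le ((-((a : ℝ) + 1) * w) / ((a : ℝ) ^ 2 + 3 * a + 3))
  have h2 := Int.lt_floor_add_one ((-((a : ℝ) + 1) * w) / ((a : ℝ) ^ 2 + 3 * a + 3))
  have h3 : (constCoeff a w : ℝ) = ⌊(-((a : ℝ) + 1) * w) / ((a : ℝ) ^ 2 + 3 * a + 3)⌋ + 1 := by
    simp [constCoeff]
  have h4 : (-((a : ℝ) + 1) * w) / ((a : ℝ) ^ 2 + 3 * a + 3)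
      = -((a + 1) * w / (a ^ 2 + 3 * a + 3)) := by ring
  rw [h4] at h1 h2 h3
  have p : 0 < (residue a w : ℝ) / (a ^ 2 + 3 * a + 3) := by rw [h]; linarith
  have q : (residue a w : ℝ) / (a ^ 2 + 3 * a + 3) ≤ 1 := by rw [h]; linarith
  rw [div_le_one hD] at q
  rw [lt_div_iff₀ hD, zero_mul] at p
  exact ⟨by exact_mod_cast p, by exact_mod_cast q⟩

lemma residue_eq_of_dvd {a w v : ℤ} (ha : 0 ≤ a) (hv1 : 1 ≤ v) (hv2 : v ≤ a ^ 2 + 3 * a + 3)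
    (h : a ^ 2 + 3 * a + 3 ∣ v - (a + 1) * w) : residue a w = v := by
  obtain ⟨h1, h2⟩ := residue_bounds ha w
  have hd : a ^ 2 + 3 * a + 3 ∣ residue a w - v := by
    have : residue a w - v = (a ^ 2 + 3 * a + 3) * constCoeff a w - (v - (a + 1) * w) := by
      rw [residue]; ring
    rw [this]
    exact dvd_sub (dvd_mul_right _ _) h
  have := Int.eq_zero_of_abs_lt_dvd hd (by rw [abs_lt]; constructor <;> linarith)
  linarith

lemma residue_injOn (a c : ℤ) :
    Set.InjOn (fun v ↦ residue a (c + v)) (Set.Icc 0 (a ^ 2 + 3 * a + 2)) := by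
  intro v hv v' hv' h
  simp only [residue] at h
  have hd : a ^ 2 + 3 * a + 3 ∣ v - v' := by
    refine ⟨v - v' + (a + 2) * (constCoeff a (c + v) - constCoeff a (c + v')), ?_⟩
    linear_combination (-(a + 2)) * h
  have := Int.eq_zero_of_abs_lt_dvd hd
    (by rw [abs_lt]; constructor <;> linarith [hv.1, hv.2, hv'.1, hv'.2])
  linarith

/-! ### Counting in fibres and sums -/

lemma card_Ioc_floor_le (c : ℝ) {T : ℝ} (hT : 0 ≤ T) :
    ((Ioc ⌊c + 1⌋ ⌊c + T⌋).card : ℝ) ≤ T := by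
  rw [Int.card_Ioc, ← Int.cast_natCast, Int.toNat_eq_max, Int.cast_max, Int.cast_zero, Int.cast_sub]
  refine max_le ?_ hT
  linarith [Int.floor_le (c + T), Int.lt_floor_add_one (c + 1)]

lemma ncard_fibres_le {ι : Type*} (I : Finset ι) (f : ι → ℤ) (c : ℤ → ℝ) (T : ι → ℝ)
    (hT : ∀ i ∈ I, 0 ≤ T i) :
    {p : ℤ × ℤ | ∃ i ∈ I, p.1 = f i ∧ c p.1 + 1 < p.2 ∧ p.2 ≤ c p.1 + T i}.Finite ∧
    ({p : ℤ × ℤ | ∃ i ∈ I, p.1 = f i ∧ c p.1 + 1 < p.2 ∧ p.2 ≤ c p.1 + T i}.ncard : ℝ)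
      ≤ ∑ i ∈ I, T i := by
  classical
  let F : Finset (ℤ × ℤ) :=
    I.biUnion fun i ↦ (Ioc ⌊c (f i) + 1⌋ ⌊c (f i) + T i⌋).image (Prod.mk (f i))
  have hsub : {p : ℤ × ℤ | ∃ i ∈ I, p.1 = f i ∧ c p.1 + 1 < p.2 ∧ p.2 ≤ c p.1 + T i} ⊆ F := by
    rintro ⟨w, o⟩ ⟨i, hi, hw, h1, h2⟩
    dsimp only at hw h1 h2
    subst hw
    simp only [F, coe_biUnion, Set.mem_iUnion, coe_image, Set.mem_image]
    refine ⟨i, hi, o, ?_, rfl⟩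
    rw [mem_coe, mem_Ioc, Int.floor_lt, Int.le_floor]
    exact ⟨h1, h2⟩
  refine ⟨F.finite_toSet.subset hsub, ?_⟩
  calc ({p : ℤ × ℤ | ∃ i ∈ I, p.1 = f i ∧ c p.1 + 1 < p.2 ∧ p.2 ≤ c p.1 + T i}.ncard : ℝ)
      ≤ F.card := by
        exact_mod_cast (Set.ncard_le_ncard hsub F.finite_toSet).trans (Set.ncard_coe_finset F).le
    _ ≤ ∑ i ∈ I, ((Ioc ⌊c (f i) + 1⌋ ⌊c (f i) + T i⌋).card : ℝ) := by
        exact_mod_cast card_biUnion_le.trans (sum_le_sum fun i _ ↦ card_image_le)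
    _ ≤ ∑ i ∈ I, T i := sum_le_sum fun i hi ↦ card_Ioc_floor_le _ (hT i hi)

lemma sum_Icc_inv_le {n : ℤ} (hn : 0 ≤ n) : ∑ i ∈ Icc 1 n, (i : ℝ)⁻¹ ≤ 1 + Real.log n := by
  lift n to ℕ using hn
  have h := harmonic_le_one_add_log n
  rw [harmonic_eq_sum_Icc] at h
  push_cast at h
  refine le_of_eq_of_le (sum_nbij' Int.toNat Nat.cast ?_ ?_ ?_ ?_ ?_) h
  · simp; lia
  · simp
  · simp; lia
  · simp
  · intro i hi
    have : ((i.toNat : ℤ) : ℝ) = i := by rw [Int.toNat_of_nonneg (by simp at hi; lia)]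
    rw [← this, Int.cast_natCast]

lemma sum_Icc_inv_sqrt_le (n : ℕ) : ∑ i ∈ Icc 1 n, (√(i : ℝ))⁻¹ ≤ 2 * √(n : ℝ) := by
  induction n with
  | zero => simp
  | succ n ih =>
    rw [sum_Icc_succ_top (by lia)]
    have hp : 0 < √((n + 1 : ℕ) : ℝ) := Real.sqrt_pos.2 (by positivity)
    have h1 : √((n + 1 : ℕ) : ℝ) ^ 2 = n + 1 := by
      rw [Real.sq_sqrt (by positivity)]; push_cast; rfl
    have h2 : √(n : ℝ) ^ 2 = n := Real.sq_sqrt (by positivity)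
    have h3 : (√((n + 1 : ℕ) : ℝ))⁻¹ ≤ 2 * √((n + 1 : ℕ) : ℝ) - 2 * √(n : ℝ) := by
      rw [inv_le_iff_one_le_mul₀ hp]
      nlinarith [sq_nonneg (√((n + 1 : ℕ) : ℝ) - √(n : ℝ))]
    linarith

lemma sum_min_le {L : ℝ} (hL : 0 < L) (n : ℕ) :
    ∑ i ∈ Icc 1 n, min (L ^ 3 / (i : ℝ) ^ 2) √(L ^ 3 / i) ≤ 4 * L ^ 2 := by
  have hsplit : ∀ m : ℕ, 1 ≤ m → L ≤ m →
      ∑ i ∈ Icc 1 n, min (L ^ 3 / (i : ℝ) ^ 2) √(L ^ 3 / i)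
        ≤ ∑ i ∈ Icc 1 m, min (L ^ 3 / (i : ℝ) ^ 2) √(L ^ 3 / i) + L ^ 2 := by
    intro m hm hLm
    have hm' : (0 : ℝ) < m := by positivity
    calc ∑ i ∈ Icc 1 n, min (L ^ 3 / (i : ℝ) ^ 2) √(L ^ 3 / i)
        ≤ ∑ i ∈ Icc 1 m ∪ Ioc m (max m n), min (L ^ 3 / (i : ℝ) ^ 2) √(L ^ 3 / i) := by
          refine sum_le_sum_of_subset_of_nonneg (fun i hi ↦ ?_) fun i _ _ ↦ by positivity
          simp only [mem_union, mem_Icc, mem_Ioc] at hi ⊢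
          lia
      _ ≤ ∑ i ∈ Icc 1 m, min (L ^ 3 / (i : ℝ) ^ 2) √(L ^ 3 / i)
          + ∑ i ∈ Ioc m (max m n), L ^ 3 * ((i : ℝ) ^ 2)⁻¹ := by
          rw [sum_union (disjoint_left.2 fun i hi hi' ↦ by
            simp only [mem_Icc, mem_Ioc] at hi hi'; lia)]
          gcongr
          exact (min_le_left _ _).trans_eq (div_eq_mul_inv _ _)
      _ ≤ ∑ i ∈ Icc 1 m, min (L ^ 3 / (i : ℝ) ^ 2) √(L ^ 3 / i) + L ^ 2 := by
          rw [← mul_sum]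
          gcongr
          have h := sum_Ioc_inv_sq_le_sub (α := ℝ) (k := m) (n := max m n) (by lia)
            (le_max_left _ _)
          have h0 : (0 : ℝ) ≤ ((max m n : ℕ) : ℝ)⁻¹ := by positivity
          calc L ^ 3 * ∑ i ∈ Ioc m (max m n), ((i : ℝ) ^ 2)⁻¹ ≤ L ^ 3 * (m : ℝ)⁻¹ := by
                gcongr; linarith
            _ ≤ L ^ 3 * L⁻¹ := by gcongr
            _ = L ^ 2 := by field_simp
  rcases le_or_gt L 1 with h1 | h1
  · have h := hsplit 1 le_rfl (by simpa using h1)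
    have : ∑ i ∈ Icc (1 : ℕ) 1, min (L ^ 3 / (i : ℝ) ^ 2) √(L ^ 3 / i) ≤ L ^ 2 := by
      simp only [Icc_self, sum_singleton]
      refine (min_le_left _ _).trans ?_
      simp only [Nat.cast_one, one_pow, div_one]
      exact pow_le_pow_of_le_one hL.le h1 (by lia)
    nlinarith
  · have h := hsplit ⌈L⌉₊ (Nat.ceil_pos.2 hL) (Nat.le_ceil L)
    have hc : (⌈L⌉₊ : ℝ) ≤ 2 * L := by linarith [Nat.ceil_lt_add_one hL.le]
    have : ∑ i ∈ Icc 1 ⌈L⌉₊, min (L ^ 3 / (i : ℝ) ^ 2) √(L ^ 3 / i) ≤ 3 * L ^ 2 := by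
      calc ∑ i ∈ Icc 1 ⌈L⌉₊, min (L ^ 3 / (i : ℝ) ^ 2) √(L ^ 3 / i)
          ≤ ∑ i ∈ Icc 1 ⌈L⌉₊, √(L ^ 3) * (√(i : ℝ))⁻¹ := by
            refine sum_le_sum fun i _ ↦ (min_le_right _ _).trans_eq ?_
            rw [Real.sqrt_div (by positivity), div_eq_mul_inv]
        _ ≤ √(L ^ 3) * (2 * √(2 * L)) := by
            rw [← mul_sum]
            gcongr
            exact (sum_Icc_inv_sqrt_le _).trans (by gcongr)
        _ = 2 * √2 * L ^ 2 := by
            rw [mul_left_comm, ← Real.sqrt_mul (by positivity),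
              show L ^ 3 * (2 * L) = 2 * (L ^ 2) ^ 2 by ring, Real.sqrt_mul (by positivity),
              Real.sqrt_sq (by positivity)]
            ring
        _ ≤ 3 * L ^ 2 := by
            gcongr
            have : √2 ≤ 3 / 2 := Real.sqrt_le_iff.2 (by norm_num)
            linarith
    linarith

lemma sum_min_le_rpow {Y : ℝ} (hY : 0 < Y) (n : ℕ) :
    ∑ i ∈ Icc 1 n, min (Y / (i : ℝ) ^ 2) √(Y / i) ≤ 4 * Y ^ ((2 : ℝ) / 3) := by
  have h := sum_min_le (Real.rpow_pos_of_pos hY (1 / 3)) n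
  rw [← Real.rpow_mul_natCast hY.le, ← Real.rpow_mul_natCast hY.le] at h
  norm_num at h ⊢
  exact h

lemma sum_Icc_reflect_inv (a : ℤ) :
    ∑ k ∈ Icc 1 a, ((a : ℝ) + 1 - k)⁻¹ = ∑ k ∈ Icc 1 a, (k : ℝ)⁻¹ := by
  refine sum_nbij' (fun k ↦ a + 1 - k) (fun k ↦ a + 1 - k) ?_ ?_ ?_ ?_ ?_ <;>
    simp <;> intros <;> lia

lemma sum_residue_inv_le {a : ℤ} (ha : 0 ≤ a) (c : ℤ) :
    ∑ v ∈ Icc (0 : ℤ) (a ^ 2 + 3 * a + 2), (residue a (c + v) : ℝ)⁻¹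
      ≤ ∑ u ∈ Icc (1 : ℤ) (a ^ 2 + 3 * a + 3), (u : ℝ)⁻¹ := by
  rw [← sum_image (f := fun u : ℤ ↦ (u : ℝ)⁻¹) (g := fun v ↦ residue a (c + v))
    (by simpa using residue_injOn a c)]
  refine sum_le_sum_of_subset_of_nonneg (fun u hu ↦ ?_) fun u hu _ ↦ ?_
  · obtain ⟨v, -, rfl⟩ := mem_image.1 hu
    exact mem_Icc.2 (residue_bounds ha _)
  · have : (1 : ℝ) ≤ u := by exact_mod_cast (mem_Icc.1 hu).1
    positivity

/-! ### Bounds for a single point -/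

section PointBounds

variable {a : ℤ} {x t : ℝ} {w : ℤ}

lemma point_bounds (ha : 8 ≤ a) {K : Type*} [Field K] [NumberField K] {σ : K →+* ℝ} {θ : K}
    (hσ : σ θ = simplestCubicRoot a) (htop : IntermediateField.adjoin ℚ {θ} = ⊤) {o : ℤ}
    (hw : 1 ≤ w) (ho : ⌊(((a : ℝ) + 2) * w) / ((a : ℝ) ^ 2 + 3 * a + 3)⌋ + 2 ≤ o)
    (hN : ((Algebra.norm ℚ ((constCoeff a w : K) - w * θ + o * θ ^ 2) : ℚ) : ℝ) ≤ x)
    (ht : t = o - (a + 2) * w / (a ^ 2 + 3 * a + 3)) :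
    1 < t ∧ t * (a ^ 2 * w * residue a w) ≤ (a ^ 2 + 3 * a + 3) * x ∧
      t ^ 2 * (a ^ 2 * residue a w) ≤ (a ^ 2 + 3 * a + 3) * x ∧ w ≤ 2 * x := by
  have ha' : (8 : ℝ) ≤ a := by exact_mod_cast ha
  have hw' : (1 : ℝ) ≤ w := by exact_mod_cast hw
  have hD : 0 < (a : ℝ) ^ 2 + 3 * a + 3 := by positivity
  have hu : (1 : ℝ) ≤ residue a w := by exact_mod_cast (residue_bounds (by lia) w).1
  have ht1 : 1 < t := by
    have h : (⌊(((a : ℝ) + 2) * w) / ((a : ℝ) ^ 2 + 3 * a + 3)⌋ : ℝ) + 2 ≤ o := by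
      exact_mod_cast ho
    linarith [Int.lt_floor_add_one ((((a : ℝ) + 2) * w) / ((a : ℝ) ^ 2 + 3 * a + 3))]
  have hprod := (norm_ge ha hσ htop (constCoeff a w) w o (residue_div (by lia) w) ht
    (by positivity) (by linarith) (by lia)).trans hN
  refine ⟨ht1, ?_, ?_, ?_⟩
  · have h : (a : ℝ) ^ 2 * t * w * (residue a w / (a ^ 2 + 3 * a + 3)) ≤ x := by
      refine le_trans ?_ hprod
      gcongr
      exacts [le_max_left _ _, le_max_left _ _]
    rw [mul_div_assoc', div_le_iff₀ hD] at h
    linarith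
  · have h : (a : ℝ) ^ 2 * t * t * (residue a w / (a ^ 2 + 3 * a + 3)) ≤ x := by
      refine le_trans ?_ hprod
      gcongr
      exacts [le_max_right _ _, le_max_left _ _]
    rw [mul_div_assoc', div_le_iff₀ hD] at h
    linarith
  · have h : (a : ℝ) ^ 2 * 1 * w * (1 / (a + 3) ^ 2) ≤ x := by
      refine le_trans ?_ hprod
      gcongr
      · exact le_max_left _ _
      · exact le_trans (by gcongr) (le_max_right _ _)
    rw [mul_one_div, div_le_iff₀ (by positivity)] at h
    have hx : 0 < x := by
      by_contra! hx
      have : 0 < (a : ℝ) ^ 2 * 1 * w := by positivity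
      nlinarith [mul_nonneg (neg_nonneg.2 hx) (sq_nonneg ((a : ℝ) + 3))]
    have h3 : ((a : ℝ) + 3) ^ 2 ≤ 2 * a ^ 2 := by nlinarith
    have h4 : (a : ℝ) ^ 2 * w ≤ a ^ 2 * (2 * x) := by nlinarith
    exact le_of_mul_le_mul_left h4 (by positivity)

lemma le_min_of_small (ha : 8 ≤ a) (hx : 0 < x) (hw : 1 ≤ w) (hwa : w ≤ a + 2)
    (h₁ : t * (a ^ 2 * w * residue a w) ≤ (a ^ 2 + 3 * a + 3) * x)
    (h₂ : t ^ 2 * (a ^ 2 * residue a w) ≤ (a ^ 2 + 3 * a + 3) * x) :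
    t ≤ min (2 * x / a / (w : ℝ) ^ 2) √(2 * x / a / w) := by
  have ha' : (8 : ℝ) ≤ a := by exact_mod_cast ha
  have hw' : (1 : ℝ) ≤ w := by exact_mod_cast hw
  rw [residue_eq_of_dvd (v := (a + 1) * w) (by lia) (by nlinarith) (by nlinarith) (by simp)]
    at h₁ h₂
  push_cast at h₁ h₂
  have hD : ((a : ℝ) ^ 2 + 3 * a + 3) * x ≤ (a * (a + 1)) * (2 * x) := by
    have h : (a : ℝ) ^ 2 + 3 * a + 3 ≤ 2 * (a * (a + 1)) := by nlinarith
    linarith [mul_le_mul_of_nonneg_right h hx.le]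
  have hp : 0 < (a : ℝ) * (a + 1) := by positivity
  apply le_min
  · rw [div_div, le_div_iff₀ (by positivity)]
    refine le_of_mul_le_mul_left (le_trans ?_ (h₁.trans hD)) hp
    apply le_of_eq; ring
  · apply Real.le_sqrt_of_sq_le
    rw [div_div, le_div_iff₀ (by positivity)]
    refine le_of_mul_le_mul_left (le_trans ?_ (h₂.trans hD)) hp
    apply le_of_eq; ring

lemma le_of_middle (ha : 8 ≤ a) (hx : 0 < x) {j k : ℤ} (hj : 1 ≤ j) (hja : j ≤ a + 2) (hk : 1 ≤ k)
    (hka : k ≤ a) (ht : 1 < t) (hw : w = j + k * (a + 2))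
    (h₁ : t * (a ^ 2 * w * residue a w) ≤ (a ^ 2 + 3 * a + 3) * x) :
    t ≤ 2 * (x / a ^ 2) * (j : ℝ)⁻¹ * ((k : ℝ)⁻¹ + ((a : ℝ) + 1 - k)⁻¹) := by
  have ha' : (8 : ℝ) ≤ a := by exact_mod_cast ha
  have hj' : (1 : ℝ) ≤ j := by exact_mod_cast hj
  have hk' : (1 : ℝ) ≤ k := by exact_mod_cast hk
  have hka' : (k : ℝ) ≤ a := by exact_mod_cast hka
  have hres : residue a w = j * (a + 1) - k := by
    refine residue_eq_of_dvd (by lia) (by nlinarith) (by nlinarith) ⟨-k, ?_⟩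
    rw [hw]; ring
  rw [hres, hw] at h₁
  push_cast at h₁
  have hpos : 0 < (a : ℝ) + 1 - k := by linarith
  have hlow : (k * (a + 2)) * (j * (a + 1 - k)) ≤ ((j : ℝ) + k * (a + 2)) * (j * (a + 1) - k) := by
    gcongr
    · linarith
    · nlinarith
  have hD : ((a : ℝ) ^ 2 + 3 * a + 3) * x ≤ ((a + 1) * (a + 2)) * (2 * x) := by nlinarith
  have hkey : t * a ^ 2 * (k * j * (a + 1 - k)) ≤ (a + 1) * (2 * x) := by
    have hp : 0 < (a : ℝ) + 2 := by positivity
    refine le_of_mul_le_mul_left ?_ hp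
    calc ((a : ℝ) + 2) * (t * a ^ 2 * (k * j * (a + 1 - k)))
        = t * a ^ 2 * ((k * (a + 2)) * (j * (a + 1 - k))) := by ring
      _ ≤ t * a ^ 2 * (((j : ℝ) + k * (a + 2)) * (j * (a + 1) - k)) := by gcongr
      _ ≤ _ := by linarith
  rw [show 2 * (x / (a : ℝ) ^ 2) * (j : ℝ)⁻¹ * ((k : ℝ)⁻¹ + ((a : ℝ) + 1 - k)⁻¹)
    = (a + 1) * (2 * x) / (a ^ 2 * (k * j * (a + 1 - k))) by field_simp; ring,
    le_div_iff₀ (by positivity)]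
  linarith

lemma le_of_large (ha : 8 ≤ a) {m v : ℤ} (hm : 1 ≤ m) (hv : 0 ≤ v) (ht : 1 < t)
    (hw : w = m * (a ^ 2 + 3 * a + 3) + v)
    (h₁ : t * (a ^ 2 * w * residue a w) ≤ (a ^ 2 + 3 * a + 3) * x) :
    t ≤ x / a ^ 2 * (m : ℝ)⁻¹ * (residue a w : ℝ)⁻¹ := by
  have ha' : (8 : ℝ) ≤ a := by exact_mod_cast ha
  have hm' : (1 : ℝ) ≤ m := by exact_mod_cast hm
  have hv' : (0 : ℝ) ≤ v := by exact_mod_cast hv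
  have hu : (1 : ℝ) ≤ residue a w := by exact_mod_cast (residue_bounds (by lia) w).1
  have hw' : (w : ℝ) = m * (a ^ 2 + 3 * a + 3) + v := by exact_mod_cast hw
  have hD : 0 < (a : ℝ) ^ 2 + 3 * a + 3 := by positivity
  rw [show x / (a : ℝ) ^ 2 * (m : ℝ)⁻¹ * (residue a w : ℝ)⁻¹ = x / (a ^ 2 * m * residue a w) by
    field_simp, le_div_iff₀ (by positivity)]
  refine le_of_mul_le_mul_left (le_trans ?_ h₁) hD
  calc ((a : ℝ) ^ 2 + 3 * a + 3) * (t * (a ^ 2 * m * residue a w))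
      = t * (a ^ 2 * (m * (a ^ 2 + 3 * a + 3)) * residue a w) := by ring
    _ ≤ t * (a ^ 2 * w * residue a w) := by gcongr; linarith

end PointBounds

lemma exists_digits {a w : ℤ} (ha : 0 ≤ a) (hw : a + 2 < w) (hwD : w < a ^ 2 + 3 * a + 3) :
    ∃ j k : ℤ, (1 ≤ j ∧ j ≤ a + 2) ∧ (1 ≤ k ∧ k ≤ a) ∧ w = j + k * (a + 2) := by
  have hp : 0 < a + 2 := by lia
  refine ⟨(w - 1) % (a + 2) + 1, (w - 1) / (a + 2), ⟨?_, ?_⟩, ⟨?_, ?_⟩, ?_⟩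
  · linarith [Int.emod_nonneg (w - 1) hp.ne']
  · linarith [Int.emod_lt_of_pos (w - 1) hp]
  · rw [Int.le_ediv_iff_mul_le hp]; lia
  · rw [← Int.lt_add_one_iff, Int.ediv_lt_iff_lt_mul hp]; nlinarith
  · linarith [Int.emod_add_mul_ediv (w - 1) (a + 2)]

lemma one_le_log {a : ℝ} (ha : 8 ≤ a) : 1 ≤ Real.log a := by
  rw [Real.le_log_iff_exp_le (by linarith)]
  linarith [Real.exp_one_lt_d9]

lemma sum_Icc_inv_le_log {a : ℝ} {n : ℤ} {s : ℝ} (ha : 8 ≤ a) (hn : 1 ≤ n) (h : n ≤ a ^ s) :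
    ∑ i ∈ Icc 1 n, (i : ℝ)⁻¹ ≤ (1 + s) * Real.log a := by
  have hn' : (1 : ℝ) ≤ n := by exact_mod_cast hn
  have := Real.log_le_log (by linarith) h
  rw [Real.log_rpow (by linarith)] at this
  linarith [sum_Icc_inv_le (n := n) (by lia), one_le_log ha]
theorem stmt_16 :
    ∀ r : ℝ, 0 < r →
    ∃ C : ℝ, 0 < C ∧
      ∀ (a : ℤ), 8 ≤ a →
      ∀ (K : Type) [Field K] [NumberField K] (σ : K →+* ℝ) (ρK : K),
        σ ρK = simplestCubicRoot a →
        IntermediateField.adjoin ℚ {ρK} = ⊤ →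
        ∀ x : ℝ, 1 ≤ x → x ≤ (a : ℝ) ^ r →
          (Set.ncard {p : ℤ × ℤ | 1 ≤ p.1 ∧
              ⌊(((a : ℝ) + 2) * p.1) / ((a : ℝ) ^ 2 + 3 * a + 3)⌋ + 2 ≤ p.2 ∧
              ((Algebra.norm ℚ
                (((⌊(-((a : ℝ) + 1) * p.1) / ((a : ℝ) ^ 2 + 3 * a + 3)⌋ + 1 : ℤ) : K)
                  - (p.1 : K) * ρK + (p.2 : K) * ρK ^ 2) : ℚ) : ℝ) ≤ x} : ℝ) ≤
            C * ((Real.log a) ^ 2 * x / (a : ℝ) ^ 2 + (x / a) ^ ((2 : ℝ) / 3)) := by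
  intro r hr
  refine ⟨44 + 4 * r, by positivity, ?_⟩
  intro a ha K _ _ σ θ hσ htop x hx hxr
  have ha' : (8 : ℝ) ≤ a := by exact_mod_cast ha
  set c : ℤ → ℝ := fun w ↦ (a + 2) * w / (a ^ 2 + 3 * a + 3) with hc
  have hY : 0 < 2 * x / a := by positivity
  have hM : 1 ≤ ⌊2 * x⌋ := Int.le_floor.2 (by push_cast; linarith)
  let I₁ : Finset ℕ := Icc 1 (a + 2).toNat
  let I₂ : Finset (ℤ × ℤ) := Icc 1 (a + 2) ×ˢ Icc 1 a
  let I₃ : Finset (ℤ × ℤ) := Icc 1 ⌊2 * x⌋ ×ˢ Icc 0 (a ^ 2 + 3 * a + 2)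
  let T₁ : ℕ → ℝ := fun i ↦ min (2 * x / a / (i : ℝ) ^ 2) √(2 * x / a / i)
  let T₂ : ℤ × ℤ → ℝ := fun q ↦
    2 * (x / a ^ 2) * (q.1 : ℝ)⁻¹ * ((q.2 : ℝ)⁻¹ + ((a : ℝ) + 1 - q.2)⁻¹)
  let T₃ : ℤ × ℤ → ℝ := fun q ↦
    x / a ^ 2 * (q.1 : ℝ)⁻¹ * (residue a (q.1 * (a ^ 2 + 3 * a + 3) + q.2) : ℝ)⁻¹
  obtain ⟨hf₁, hn₁⟩ := ncard_fibres_le I₁ (fun i ↦ (i : ℤ)) c T₁ fun i _ ↦ by positivity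
  obtain ⟨hf₂, hn₂⟩ := ncard_fibres_le I₂ (fun q ↦ q.1 + q.2 * (a + 2)) c T₂ fun q hq ↦ by
    simp only [I₂, mem_product, mem_Icc] at hq
    have h1 : (1 : ℝ) ≤ q.1 := by exact_mod_cast hq.1.1
    have h2 : (1 : ℝ) ≤ q.2 := by exact_mod_cast hq.2.1
    have h3 : (q.2 : ℝ) ≤ a := by exact_mod_cast hq.2.2
    have h4 : 0 < (a : ℝ) + 1 - q.2 := by linarith
    positivity
  obtain ⟨hf₃, hn₃⟩ := ncard_fibres_le I₃ (fun q ↦ q.1 * (a ^ 2 + 3 * a + 3) + q.2) c T₃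
    fun q hq ↦ by
    simp only [I₃, mem_product, mem_Icc] at hq
    have h1 : (1 : ℝ) ≤ q.1 := by exact_mod_cast hq.1.1
    have h2 : (1 : ℝ) ≤ residue a (q.1 * (a ^ 2 + 3 * a + 3) + q.2) := by
      exact_mod_cast (residue_bounds (by lia) _).1
    positivity
  have hcover := Set.ncard_le_ncard (s := {p : ℤ × ℤ | 1 ≤ p.1 ∧
      ⌊(((a : ℝ) + 2) * p.1) / ((a : ℝ) ^ 2 + 3 * a + 3)⌋ + 2 ≤ p.2 ∧
      ((Algebra.norm ℚ (((⌊(-((a : ℝ) + 1) * p.1) / ((a : ℝ) ^ 2 + 3 * a + 3)⌋ + 1 : ℤ) : K)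
        - (p.1 : K) * θ + (p.2 : K) * θ ^ 2) : ℚ) : ℝ) ≤ x}) (ht := (hf₁.union hf₂).union hf₃) (by
    rintro ⟨w, o⟩ ⟨hw, ho, hN⟩
    dsimp only at hw ho hN
    obtain ⟨ht, h₁, h₂, hwx⟩ := point_bounds ha hσ htop hw ho hN rfl
    have hc1 : c w + 1 < o := by simp only [hc]; linarith
    have hc2 : ∀ T : ℝ, (o : ℝ) - (a + 2) * w / (a ^ 2 + 3 * a + 3) ≤ T → (o : ℝ) ≤ c w + T :=
      fun T hT ↦ by simp only [hc]; linarith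
    rcases le_or_gt w (a + 2) with hwa | hwa
    · refine Or.inl (Or.inl ⟨w.toNat, ?_, ?_, hc1, hc2 _ ?_⟩)
      · simp only [I₁, mem_Icc]; lia
      · simp only; lia
      · have hcast : ((w.toNat : ℕ) : ℝ) = w := by
          rw [← Int.cast_natCast, Int.toNat_of_nonneg (by lia)]
        simp only [T₁, hcast]
        exact le_min_of_small ha (by linarith) hw hwa h₁ h₂
    rcases lt_or_ge w (a ^ 2 + 3 * a + 3) with hwD | hwD
    · obtain ⟨j, k, hj, hk, hjk⟩ := exists_digits (by lia) hwa hwD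
      refine Or.inl (Or.inr ⟨(j, k), ?_, hjk, hc1, hc2 _ ?_⟩)
      · simp only [I₂, mem_product, mem_Icc]
        exact ⟨hj, hk⟩
      · exact le_of_middle ha (by linarith) hj.1 hj.2 hk.1 hk.2 ht hjk h₁
    · have hD : 0 < a ^ 2 + 3 * a + 3 := by positivity
      have hdiv : w = w / (a ^ 2 + 3 * a + 3) * (a ^ 2 + 3 * a + 3) + w % (a ^ 2 + 3 * a + 3) := by
        linarith [Int.emod_add_mul_ediv w (a ^ 2 + 3 * a + 3)]
      have hv := Int.emod_nonneg w hD.ne'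
      have hm : 1 ≤ w / (a ^ 2 + 3 * a + 3) := by rw [Int.le_ediv_iff_mul_le hD]; lia
      refine Or.inr ⟨(w / (a ^ 2 + 3 * a + 3), w % (a ^ 2 + 3 * a + 3)), ?_, hdiv, hc1, hc2 _ ?_⟩
      · simp only [I₃, mem_product, mem_Icc]
        refine ⟨⟨hm, ?_⟩, hv, ?_⟩
        · exact (Int.ediv_le_self _ (by lia)).trans (Int.le_floor.2 hwx)
        · linarith [Int.emod_lt_of_pos w hD]
      · simp only [T₃, ← hdiv]
        exact le_of_large ha hm hv ht hdiv h₁)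
  have hcount := hcover.trans ((Set.ncard_union_le _ _).trans
    (Nat.add_le_add_right (Set.ncard_union_le _ _) _))
  have hlog := one_le_log ha'
  have hHa2 : ∑ i ∈ Icc 1 (a + 2), (i : ℝ)⁻¹ ≤ 3 * Real.log a := by
    refine (sum_Icc_inv_le_log (s := 2) ha' (by lia) ?_).trans_eq (by ring)
    rw [Real.rpow_ofNat]; push_cast; nlinarith
  have hHa : ∑ i ∈ Icc 1 a, (i : ℝ)⁻¹ ≤ 3 * Real.log a := by
    refine (sum_Icc_inv_le_log (s := 2) ha' (by lia) ?_).trans_eq (by ring)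
    rw [Real.rpow_ofNat]; nlinarith
  have hHD : ∑ i ∈ Icc (1 : ℤ) (a ^ 2 + 3 * a + 3), (i : ℝ)⁻¹ ≤ 4 * Real.log a := by
    refine (sum_Icc_inv_le_log (s := 3) ha' (by nlinarith) ?_).trans_eq (by ring)
    rw [Real.rpow_ofNat]; push_cast; nlinarith [mul_nonneg (sq_nonneg (a : ℝ)) (sub_nonneg.2 ha')]
  have hHM : ∑ i ∈ Icc 1 ⌊2 * x⌋, (i : ℝ)⁻¹ ≤ (2 + r) * Real.log a := by
    refine (sum_Icc_inv_le_log (s := 1 + r) ha' hM ?_).trans_eq (by ring)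
    refine (Int.floor_le _).trans ?_
    rw [Real.rpow_add (by linarith), Real.rpow_one]
    gcongr
    linarith
  have hs₁ : ∑ i ∈ I₁, T₁ i ≤ 8 * (x / a) ^ ((2 : ℝ) / 3) := by
    refine (sum_min_le_rpow hY _).trans ?_
    rw [mul_div_assoc, Real.mul_rpow (by norm_num) (by positivity)]
    have : (2 : ℝ) ^ ((2 : ℝ) / 3) ≤ 2 :=
      (Real.rpow_le_rpow_of_exponent_le (by norm_num) (by norm_num)).trans_eq (Real.rpow_one 2)
    have h0 : 0 ≤ (x / a) ^ ((2 : ℝ) / 3) := by positivity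
    nlinarith
  have hs₂ : ∑ q ∈ I₂, T₂ q ≤ 36 * (Real.log a ^ 2 * (x / a ^ 2)) := by
    have : ∑ q ∈ I₂, T₂ q = 2 * (x / a ^ 2) * (∑ i ∈ Icc 1 (a + 2), (i : ℝ)⁻¹)
        * (2 * ∑ i ∈ Icc 1 a, (i : ℝ)⁻¹) := by
      simp only [I₂, T₂, sum_product]
      simp_rw [← mul_sum, sum_add_distrib, sum_Icc_reflect_inv, ← sum_mul, ← mul_sum]
      ring
    rw [this]
    calc _ ≤ 2 * (x / (a : ℝ) ^ 2) * (3 * Real.log a) * (2 * (3 * Real.log a)) := by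
          gcongr
          exact mul_nonneg zero_le_two (sum_nonneg fun i hi ↦ by
            have : (1 : ℝ) ≤ i := by exact_mod_cast (mem_Icc.1 hi).1
            positivity)
      _ = _ := by ring
  have hs₃ : ∑ q ∈ I₃, T₃ q ≤ (8 + 4 * r) * (Real.log a ^ 2 * (x / a ^ 2)) := by
    simp only [I₃, T₃, sum_product]
    simp_rw [← mul_sum]
    calc _ ≤ ∑ m ∈ Icc 1 ⌊2 * x⌋, x / (a : ℝ) ^ 2 * (m : ℝ)⁻¹ * (4 * Real.log a) := by
          refine sum_le_sum fun m hm ↦ ?_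
          have : (1 : ℝ) ≤ m := by exact_mod_cast (mem_Icc.1 hm).1
          gcongr
          exact (sum_residue_inv_le (by lia) _).trans hHD
      _ = x / (a : ℝ) ^ 2 * (∑ m ∈ Icc 1 ⌊2 * x⌋, (m : ℝ)⁻¹) * (4 * Real.log a) := by
          rw [← sum_mul, ← mul_sum]
      _ ≤ x / (a : ℝ) ^ 2 * ((2 + r) * Real.log a) * (4 * Real.log a) := by gcongr
      _ = _ := by ring
  have h0 : 0 ≤ (x / a) ^ ((2 : ℝ) / 3) := by positivity
  refine ((Nat.cast_le (α := ℝ)).2 hcount).trans ?_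
  push_cast
  rw [mul_div_assoc]
  nlinarith [mul_nonneg hr.le h0]
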